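/- For every real number λ ≥ −1, the characteristic polynomial of the 6×6 matrix H_toy(0,λ) equals (X² + λ)·(X² + 9λ)·(X² + 25λ) = X^6 + 35λ·X^4 + 259λ²·X² + 225λ³. -/

import Mathlib

open Matrix Polynomial

/-- The `6 × 6` real matrix `H_toy(g,λ)`: diagonal `(−5+g, −3, −1, 1, 3, 5−g)`,
superdiagonal `(√(5+5λ), 2√(2+2λ), 3√(1+λ), 2√(2+2λ), √(5+5λ))`, subdiagonal the
negatives of the corresponding superdiagonal entries, all other entries zero. -/
noncomputable def Htoy (g lam : ℝ) : Matrix (Fin 6) (Fin 6) ℝ :=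
  !![-5+g, Real.sqrt (5+5*lam), 0, 0, 0, 0;
     -Real.sqrt (5+5*lam), -3, 2*Real.sqrt (2+2*lam), 0, 0, 0;
     0, -(2*Real.sqrt (2+2*lam)), -1, 3*Real.sqrt (1+lam), 0, 0;
     0, 0, -(3*Real.sqrt (1+lam)), 1, 2*Real.sqrt (2+2*lam), 0;
     0, 0, 0, -(2*Real.sqrt (2+2*lam)), 3, Real.sqrt (5+5*lam);
     0, 0, 0, 0, -Real.sqrt (5+5*lam), 5-g]

theorem Matrix.det_fin_six_tridiagonal {R : Type*} [CommRing R]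
    (a₁ a₂ a₃ a₄ a₅ a₆ b₁ b₂ b₃ b₄ b₅ c₁ c₂ c₃ c₄ c₅ : R) :
    (!![a₁, b₁, 0, 0, 0, 0;
        c₁, a₂, b₂, 0, 0, 0;
        0, c₂, a₃, b₃, 0, 0;
        0, 0, c₃, a₄, b₄, 0;
        0, 0, 0, c₄, a₅, b₅;
        0, 0, 0, 0, c₅, a₆] : Matrix (Fin 6) (Fin 6) R).det =
      a₁ * (a₂ * (a₃ * (a₄ * (a₅ * a₆ - b₅ * c₅) - b₄ * c₄ * a₆)
          - b₃ * c₃ * (a₅ * a₆ - b₅ * c₅))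
        - b₂ * c₂ * (a₄ * (a₅ * a₆ - b₅ * c₅) - b₄ * c₄ * a₆))
      - b₁ * c₁ * (a₃ * (a₄ * (a₅ * a₆ - b₅ * c₅) - b₄ * c₄ * a₆)
        - b₃ * c₃ * (a₅ * a₆ - b₅ * c₅)) := by
  simp [Matrix.det_succ_row_zero, Fin.sum_univ_succ, Fin.succAbove]
  ring

theorem Matrix.charpoly_fin_six_tridiagonal {R : Type*} [CommRing R]
    (a₁ a₂ a₃ a₄ a₅ a₆ b₁ b₂ b₃ b₄ b₅ c₁ c₂ c₃ c₄ c₅ : R) :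
    (!![a₁, b₁, 0, 0, 0, 0;
        c₁, a₂, b₂, 0, 0, 0;
        0, c₂, a₃, b₃, 0, 0;
        0, 0, c₃, a₄, b₄, 0;
        0, 0, 0, c₄, a₅, b₅;
        0, 0, 0, 0, c₅, a₆] : Matrix (Fin 6) (Fin 6) R).charpoly =
      (X - C a₁) * ((X - C a₂) * ((X - C a₃) * ((X - C a₄) *
              ((X - C a₅) * (X - C a₆) - C (b₅ * c₅)) - C (b₄ * c₄) * (X - C a₆))
          - C (b₃ * c₃) * ((X - C a₅) * (X - C a₆) - C (b₅ * c₅)))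
        - C (b₂ * c₂) * ((X - C a₄) * ((X - C a₅) * (X - C a₆) - C (b₅ * c₅))
          - C (b₄ * c₄) * (X - C a₆)))
      - C (b₁ * c₁) * ((X - C a₃) * ((X - C a₄) * ((X - C a₅) * (X - C a₆) - C (b₅ * c₅))
          - C (b₄ * c₄) * (X - C a₆))
        - C (b₃ * c₃) * ((X - C a₅) * (X - C a₆) - C (b₅ * c₅))) := by
  have h := Matrix.det_fin_six_tridiagonal (X - C a₁) (X - C a₂) (X - C a₃) (X - C a₄)
    (X - C a₅) (X - C a₆) (-C b₁) (-C b₂) (-C b₃) (-C b₄) (-C b₅)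
    (-C c₁) (-C c₂) (-C c₃) (-C c₄) (-C c₅)
  simp only [neg_mul_neg, ← C_mul] at h
  rw [← h, Matrix.charpoly]
  congr 1
  ext1 i j
  fin_cases i <;> fin_cases j <;> simp

theorem Htoy_zero_charpoly (lam : ℝ) (hlam : -1 ≤ lam) :
    (Htoy 0 lam).charpoly = (X^2 + C lam) * (X^2 + C (9*lam)) * (X^2 + C (25*lam)) := by
  have h₁ : √(5 + 5 * lam) * -√(5 + 5 * lam) = -(5 * (1 + lam)) := by
    rw [mul_neg, Real.mul_self_sqrt (by linarith)]; ring
  have h₂ : 2 * √(2 + 2 * lam) * -(2 * √(2 + 2 * lam)) = -(8 * (1 + lam)) := by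
    have := Real.mul_self_sqrt (show 0 ≤ 2 + 2 * lam by linarith)
    linear_combination -4 * this
  have h₃ : 3 * √(1 + lam) * -(3 * √(1 + lam)) = -(9 * (1 + lam)) := by
    have := Real.mul_self_sqrt (show 0 ≤ 1 + lam by linarith)
    linear_combination -9 * this
  rw [Htoy, Matrix.charpoly_fin_six_tridiagonal, h₁, h₂, h₃]
  simp only [add_zero, sub_zero, map_neg, map_mul, map_add, map_one, map_ofNat]
  ring

/-- For every `λ ≥ −1`, the characteristic polynomial of `H_toy(0,λ)` equals
`(X² + λ)(X² + 9λ)(X² + 25λ) = X^6 + 35λX^4 + 259λ²X² + 225λ³`. -/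
theorem stmt14 (lam : ℝ) (hlam : -1 ≤ lam) :
    (Htoy 0 lam).charpoly = (X^2 + C lam) * (X^2 + C (9*lam)) * (X^2 + C (25*lam)) ∧
    (Htoy 0 lam).charpoly =
      X^6 + C (35*lam) * X^4 + C (259*lam^2) * X^2 + C (225*lam^3) := by
  refine ⟨Htoy_zero_charpoly lam hlam, ?_⟩
  rw [Htoy_zero_charpoly lam hlam]
  simp only [map_mul, map_pow, map_ofNat]
  ring
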